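/- There exists a constant C > 0 such that for every A > 1 and every strictly positive continuously differentiable ℤ²-periodic probability density f on the two-dimensional torus T², ‖f‖_{L²(T²)}² ≤ C·[ ( (log A)^{−1} · ∫_{T²} f·log₊(f) )^{1/2} · ( I(f) + 1 ) + A² ], where I(f) := ∫_{T²} |∇f|²/f dx is the Fisher information and log₊(t) := max(log t, 0). -/

import Mathlib

open MeasureTheory

/-- The unit square `[0,1)²`, a fundamental domain of the torus `T² = ℝ²/ℤ²`. -/
def unitSquare : Set (EuclideanSpace ℝ (Fin 2)) :=
  {x | ∀ i, x i ∈ Set.Ico (0 : ℝ) 1}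

/-- The lattice vector of `ℝ²` associated to `m ∈ ℤ²`. -/
noncomputable def latVec (m : Fin 2 → ℤ) : EuclideanSpace ℝ (Fin 2) :=
  (WithLp.equiv 2 (Fin 2 → ℝ)).symm fun i => (m i : ℝ)


abbrev E2 := EuclideanSpace ℝ (Fin 2)

lemma line_bound (g g' h : ℝ → ℝ) (hg : ∀ t, HasDerivAt g (g' t) t) (hg' : Continuous g')
    (hh : Continuous h) (hb : ∀ t, |g' t| ≤ h t) (x : ℝ) (hx : x ∈ Set.Ico (0:ℝ) 1) :
    g x ≤ ∫ s in Set.Ico (0:ℝ) 1, (g s + h s) := by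
  have hgc : Continuous g := continuous_iff_continuousAt.2 fun t => (hg t).continuousAt
  have ih : ∀ k : ℝ → ℝ, Continuous k → IntegrableOn k (Set.Ico (0:ℝ) 1) := fun k hk =>
    (hk.continuousOn.integrableOn_compact isCompact_Icc).mono_set Set.Ico_subset_Icc_self
  have key : ∀ s ∈ Set.Ico (0:ℝ) 1, g x ≤ g s + ∫ t in Set.Ico (0:ℝ) 1, h t := by
    intro s hs
    have h1 := intervalIntegral.integral_eq_sub_of_hasDerivAt (a := s) (b := x)
      (fun t _ => hg t) (hg'.intervalIntegrable _ _)
    have h2 := intervalIntegral.norm_integral_le_integral_norm_uIoc (a := s) (b := x) (f := g')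
      (μ := volume)
    have hsub : Set.uIoc s x ⊆ Set.Ico 0 1 := by
      intro t ht
      rw [Set.uIoc, Set.mem_Ioc] at ht
      exact ⟨(le_min hs.1 hx.1).trans ht.1.le, ht.2.trans_lt (max_lt hs.2 hx.2)⟩
    have h3 : ∫ t in Set.uIoc s x, ‖g' t‖ ≤ ∫ t in Set.uIoc s x, h t :=
      integral_mono ((ih _ hg'.norm).mono_set hsub) ((ih _ hh).mono_set hsub)
        (fun t => hb t)
    have h4 : ∫ t in Set.uIoc s x, h t ≤ ∫ t in Set.Ico (0:ℝ) 1, h t :=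
      setIntegral_mono_set (ih _ hh)
        (Filter.Eventually.of_forall fun t => (abs_nonneg _).trans (hb t))
        (Filter.Eventually.of_forall hsub)
    rw [h1] at h2
    have := (Real.norm_eq_abs _ ▸ le_abs_self (g x - g s)).trans h2
    linarith
  have h5 : ∫ s in Set.Ico (0:ℝ) 1, g x ≤
      ∫ s in Set.Ico (0:ℝ) 1, (g s + ∫ t in Set.Ico (0:ℝ) 1, h t) :=
    setIntegral_mono_on (ih _ continuous_const) (ih _ (hgc.add continuous_const))
      measurableSet_Ico key
  rw [integral_add (ih _ hgc) (ih _ continuous_const)] at h5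
  rw [integral_add (ih _ hgc) (ih _ hh)]
  simpa using h5

lemma prod_bound (G G1 G2 D : ℝ × ℝ → ℝ) (hG : Continuous G) (hG0 : ∀ p, 0 ≤ G p)
    (hG1 : Continuous G1) (hG2 : Continuous G2) (hD : Continuous D)
    (h1 : ∀ x y, HasDerivAt (fun t => G (t, y)) (G1 (x, y)) x)
    (h2 : ∀ x y, HasDerivAt (fun t => G (x, t)) (G2 (x, y)) y)
    (hb1 : ∀ p, |G1 p| ≤ D p) (hb2 : ∀ p, |G2 p| ≤ D p) :
    ∫ p in Set.Ico (0:ℝ) 1 ×ˢ Set.Ico (0:ℝ) 1, G p ^ 2 ≤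
      (∫ p in Set.Ico (0:ℝ) 1 ×ˢ Set.Ico (0:ℝ) 1, (G p + D p)) ^ 2 := by
  have ih : ∀ k : ℝ × ℝ → ℝ, Continuous k →
      IntegrableOn k (Set.Ico (0:ℝ) 1 ×ˢ Set.Ico (0:ℝ) 1) := fun k hk =>
    (hk.continuousOn.integrableOn_compact (isCompact_Icc.prod isCompact_Icc)).mono_set
      (Set.prod_mono Set.Ico_subset_Icc_self Set.Ico_subset_Icc_self)
  set ν := (volume : Measure ℝ).restrict (Set.Ico (0:ℝ) 1) with hν
  have hvol : (volume : Measure (ℝ × ℝ)).restrict (Set.Ico (0:ℝ) 1 ×ˢ Set.Ico (0:ℝ) 1)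
      = ν.prod ν := by
    rw [hν, Measure.prod_restrict]; rfl
  have iS := ih _ (hG.add hD)
  have iQ := ih _ (hG.pow 2)
  rw [IntegrableOn, hvol] at iS iQ
  have hab : ∀ p ∈ Set.Ico (0:ℝ) 1 ×ˢ Set.Ico (0:ℝ) 1, G p ^ 2 ≤
      (∫ y, (G (p.1, y) + D (p.1, y)) ∂ν) * (∫ x, (G (x, p.2) + D (x, p.2)) ∂ν) := by
    rintro ⟨x, y⟩ ⟨hx, hy⟩
    have e1 := line_bound (fun t => G (t, y)) (fun t => G1 (t, y)) (fun t => D (t, y))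
      (fun t => h1 t y) (by fun_prop) (by fun_prop) (fun t => hb1 _) x hx
    have e2 := line_bound (fun t => G (x, t)) (fun t => G2 (x, t)) (fun t => D (x, t))
      (fun t => h2 x t) (by fun_prop) (by fun_prop) (fun t => hb2 _) y hy
    rw [sq]
    exact mul_le_mul e2 e1 (hG0 _) ((hG0 _).trans e2)
  have hle : ∫ p, G p ^ 2 ∂(ν.prod ν) ≤ ∫ p : ℝ × ℝ,
      (∫ y, (G (p.1, y) + D (p.1, y)) ∂ν) * (∫ x, (G (x, p.2) + D (x, p.2)) ∂ν) ∂(ν.prod ν) := by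
    refine integral_mono_ae iQ (iS.integral_prod_left.mul_prod iS.integral_prod_right) ?_
    rw [← hvol]
    exact (ae_restrict_iff' (measurableSet_Ico.prod measurableSet_Ico)).2
      (Filter.Eventually.of_forall hab)
  rw [hvol]
  refine hle.trans (le_of_eq ?_)
  rw [integral_prod_mul (fun x => ∫ y, (G (x, y) + D (x, y)) ∂ν)
    (fun y => ∫ x, (G (x, y) + D (x, y)) ∂ν), sq]
  congr 1
  · exact (integral_prod _ iS).symm
  · exact (integral_prod_symm _ iS).symm

lemma sq_transfer (g : E2 → ℝ) :
    ∫ x in unitSquare, g x =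
      ∫ p in Set.Ico (0:ℝ) 1 ×ˢ Set.Ico (0:ℝ) 1, g !₂[p.1, p.2] := by
  have hm := (volume_preserving_finTwoArrow ℝ).comp
    (EuclideanSpace.volume_preserving_symm_measurableEquiv_toLp (Fin 2))
  have := hm.setIntegral_preimage_emb
    ((MeasurableEquiv.toLp 2 (Fin 2 → ℝ)).symm.trans
      MeasurableEquiv.finTwoArrow).measurableEmbedding
    (fun p => g !₂[p.1, p.2]) (Set.Ico (0:ℝ) 1 ×ˢ Set.Ico (0:ℝ) 1)
  rw [← this]
  have hs : unitSquare = (⇑MeasurableEquiv.finTwoArrow ∘ ⇑(MeasurableEquiv.toLp 2 (Fin 2 → ℝ)).symm) ⁻¹' Set.Ico (0:ℝ) 1 ×ˢ Set.Ico (0:ℝ) 1 := by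
    ext x
    simp [unitSquare, Fin.forall_fin_two, MeasurableEquiv.finTwoArrow]
  rw [hs]
  congr 1
  ext x
  congr 1
  ext i
  fin_cases i <;> simp [MeasurableEquiv.finTwoArrow]

lemma unitSquare_meas : MeasurableSet unitSquare := by
  have : unitSquare = ⋂ i : Fin 2, (fun x : E2 => x i) ⁻¹' Set.Ico (0:ℝ) 1 := by
    ext x; simp [unitSquare]
  rw [this]
  exact MeasurableSet.iInter fun i =>
    (Continuous.measurable (by fun_prop)) measurableSet_Ico

lemma unitSquare_int (k : E2 → ℝ) (hk : Continuous k) : IntegrableOn k unitSquare := by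
  refine (hk.continuousOn.integrableOn_compact
    (isCompact_closedBall (0 : E2) 2)).mono_set ?_
  intro x hx
  rw [mem_closedBall_zero_iff, EuclideanSpace.norm_eq, Real.sqrt_le_left (by norm_num)]
  have h0 := hx 0
  have h1 := hx 1
  simp only [Fin.sum_univ_two, Real.norm_eq_abs, sq_abs]
  nlinarith [h0.1, h0.2, h1.1, h1.2]

lemma sobolev (G : E2 → ℝ) (G' : E2 → (E2 →L[ℝ] ℝ)) (hG0 : ∀ x, 0 ≤ G x)
    (hG : ∀ x, HasFDerivAt G (G' x) x) (hG' : Continuous G') :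
    ∫ x in unitSquare, G x ^ 2 ≤ (∫ x in unitSquare, (G x + ‖G' x‖)) ^ 2 := by
  have hGc : Continuous G := continuous_iff_continuousAt.2 fun t => (hG t).continuousAt
  have hc : Continuous (fun p : ℝ × ℝ => (!₂[p.1, p.2] : E2)) := by fun_prop
  have hn : ∀ (L : E2 →L[ℝ] ℝ) (v : E2), ‖v‖ = 1 → |L v| ≤ ‖L‖ := fun L v hv => by
    simpa [hv] using L.le_opNorm v
  rw [sq_transfer, sq_transfer]
  refine prod_bound (fun p => G !₂[p.1, p.2])
    (fun p => G' !₂[p.1, p.2] (EuclideanSpace.single 0 1))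
    (fun p => G' !₂[p.1, p.2] (EuclideanSpace.single 1 1))
    (fun p => ‖G' !₂[p.1, p.2]‖) (by fun_prop) (fun _ => hG0 _) (by fun_prop) (by fun_prop)
    (by fun_prop) ?_ ?_ (fun p => hn _ _ (by simp)) (fun p => hn _ _ (by simp))
  · intro x y
    have hl : HasDerivAt (fun t : ℝ => (!₂[t, y] : E2)) (EuclideanSpace.single 0 1) x := by
      have h := ((hasDerivAt_id x).smul_const (EuclideanSpace.single 0 1 : E2)).const_add
        (!₂[0, y] : E2)
      rw [one_smul] at h
      convert! h using 1
      ext t i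
      fin_cases i <;> simp
    exact (hG _).comp_hasDerivAt x hl
  · intro x y
    have hl : HasDerivAt (fun t : ℝ => (!₂[x, t] : E2)) (EuclideanSpace.single 1 1) y := by
      have h := ((hasDerivAt_id y).smul_const (EuclideanSpace.single 1 1 : E2)).const_add
        (!₂[x, 0] : E2)
      rw [one_smul] at h
      convert! h using 1
      ext t i
      fin_cases i <;> simp
    exact (hG _).comp_hasDerivAt y hl

lemma hasDerivAt_max_sq (t : ℝ) : HasDerivAt (fun t : ℝ => max t 0 ^ 2) (2 * max t 0) t := by
  rcases lt_trichotomy t 0 with h | h | h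
  · have : (fun t : ℝ => max t 0 ^ 2) =ᶠ[nhds t] fun _ => 0 := by
      filter_upwards [gt_mem_nhds h] with s hs
      simp [max_eq_right hs.le]
    rw [max_eq_right h.le]
    simpa using (hasDerivAt_const t (0:ℝ)).congr_of_eventuallyEq this
  · subst h
    rw [hasDerivAt_iff_isLittleO]
    have : (fun x' : ℝ => x' ^ 2) =o[nhds 0] fun x' => x' := by
      simpa using Asymptotics.isLittleO_pow_pow (𝕜 := ℝ) (one_lt_two)
    refine (Asymptotics.IsBigO.of_bound 1 (Filter.Eventually.of_forall fun x => ?_)).trans_isLittleO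
      (by simpa using this)
    simp only [max_self, mul_zero, smul_zero, sub_zero, Real.norm_eq_abs, one_mul]
    rcases le_total x 0 with hx | hx
    · simp [max_eq_right hx, sq_nonneg]
    · simp [max_eq_left hx]
  · have : (fun t : ℝ => max t 0 ^ 2) =ᶠ[nhds t] fun s => s ^ 2 := by
      filter_upwards [lt_mem_nhds h] with s hs
      simp [max_eq_left hs.le]
    rw [max_eq_left h.le]
    simpa using (hasDerivAt_pow 2 t).congr_of_eventuallyEq this

theorem stmt17 :
    ∃ C : ℝ, 0 < C ∧
      ∀ A : ℝ, 1 < A →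
        ∀ f : EuclideanSpace ℝ (Fin 2) → ℝ,
          ContDiff ℝ 1 f → (∀ x, 0 < f x) →
          (∀ x m, f (x + latVec m) = f x) →
          (∫ x in unitSquare, f x) = 1 →
          (∫ x in unitSquare, (f x) ^ 2) ≤
            C * (Real.sqrt ((∫ x in unitSquare, f x * max (Real.log (f x)) 0) / Real.log A) *
                  ((∫ x in unitSquare, ‖fderiv ℝ f x‖ ^ 2 / f x) + 1) +
                A ^ 2) := by
  refine ⟨8, by norm_num, ?_⟩
  intro A hA f hf hpos _ hint
  have hlogA : 0 < Real.log A := Real.log_pos hA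
  have hA0 : 0 < A := by linarith
  have hfc : Continuous f := hf.continuous
  have hne : ∀ x, f x ≠ 0 := fun x => (hpos x).ne'
  have hf' : Continuous (fderiv ℝ f) := hf.continuous_fderiv (by norm_num)
  obtain ⟨u, hu⟩ : ∃ u : E2 → ℝ, u = fun x => max (f x - A) 0 / f x := ⟨_, rfl⟩
  have huc : Continuous u := by
    rw [hu]; exact ((hfc.sub continuous_const).max continuous_const).div hfc hne
  have hu0 : ∀ x, 0 ≤ u x := fun x => by
    rw [hu]; exact div_nonneg (le_max_right _ _) (hpos x).le
  have hu1 : ∀ x, u x ≤ 1 := fun x => by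
    rw [hu]; exact (div_le_one (hpos x)).2 (max_le (by linarith) (hpos x).le)
  have hfu : ∀ x, f x * u x = max (f x - A) 0 := fun x => by
    rw [hu]; exact mul_div_cancel₀ _ (hne x)
  have hlog : ∀ x, u x ≠ 0 → Real.log A ≤ max (Real.log (f x)) 0 := fun x hx => by
    refine le_max_of_le_left (Real.log_le_log hA0 ?_)
    by_contra hlt
    apply hx
    rw [hu]
    simp only
    rw [max_eq_right (by linarith)]; simp
  obtain ⟨ψ, hψ⟩ : ∃ ψ : E2 → ℝ, ψ = fun x => 2 * u x - u x ^ 2 := ⟨_, rfl⟩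
  have hψc : Continuous ψ := by rw [hψ]; fun_prop
  have hψ0 : ∀ x, 0 ≤ ψ x := fun x => by rw [hψ]; nlinarith [hu0 x, hu1 x]
  have hψ1 : ∀ x, ψ x ≤ 1 := fun x => by rw [hψ]; nlinarith [sq_nonneg (u x - 1)]
  have hder : ∀ x, HasFDerivAt (fun x => f x * u x ^ 2) (ψ x • fderiv ℝ f x) x := by
    intro x
    have hfx : HasFDerivAt f (fderiv ℝ f x) x := (hf.differentiable (by norm_num) x).hasFDerivAt
    have h1 : HasDerivAt (fun t : ℝ => max (t - A) 0 ^ 2 / t) (ψ x) (f x) := by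
      have h2 := ((hasDerivAt_max_sq (f x - A)).comp_sub_const (f x) A).div
        (hasDerivAt_id (f x)) (hne x)
      convert! h2 using 1
      rw [hψ, hu]
      have := hne x
      simp only [id]
      field_simp
    have h3 := h1.comp_hasFDerivAt x hfx
    convert! h3 using 1
    ext y
    rw [hu]
    have := hne y
    simp only [Function.comp]
    field_simp
  have hS := sobolev (fun x => f x * u x ^ 2) (fun x => ψ x • fderiv ℝ f x)
    (fun x => mul_nonneg (hpos x).le (sq_nonneg _)) hder (hψc.smul hf')
  simp only [norm_smul, Real.norm_eq_abs, abs_of_nonneg (hψ0 _)] at hS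
  -- integrability
  have hLc : Continuous (fun x => f x * max (Real.log (f x)) 0) :=
    hfc.mul ((hfc.log hne).max continuous_const)
  have hIc : Continuous (fun x => ‖fderiv ℝ f x‖ ^ 2 / f x) := (hf'.norm.pow 2).div hfc hne
  have iL := unitSquare_int _ hLc
  have iI := unitSquare_int _ hIc
  have if1 := unitSquare_int _ hfc
  have if2 := unitSquare_int _ (hfc.pow 2)
  have iG := unitSquare_int (fun x => f x * u x ^ 2) (by fun_prop)
  have iG2 := unitSquare_int (fun x => (f x * u x ^ 2) ^ 2) (by fun_prop)
  have iM := unitSquare_int (fun x => ψ x * f x) (by fun_prop)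
  have iD := unitSquare_int (fun x => ψ x * ‖fderiv ℝ f x‖) (by fun_prop)
  rw [integral_add iG iD] at hS
  set I := ∫ x in unitSquare, ‖fderiv ℝ f x‖ ^ 2 / f x with hI
  set L := ∫ x in unitSquare, f x * max (Real.log (f x)) 0 with hL
  set M := ∫ x in unitSquare, ψ x * f x with hM
  set D := ∫ x in unitSquare, ψ x * ‖fderiv ℝ f x‖ with hD
  set K := ∫ x in unitSquare, f x * u x ^ 2 with hK
  have hI0 : 0 ≤ I := integral_nonneg fun x => div_nonneg (sq_nonneg _) (hpos x).le
  have hM0 : 0 ≤ M := integral_nonneg fun x => mul_nonneg (hψ0 x) (hpos x).le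
  have hK0 : 0 ≤ K := integral_nonneg fun x => mul_nonneg (hpos x).le (sq_nonneg _)
  have hM1 : M ≤ 1 := by
    rw [← hint]
    exact integral_mono iM if1 fun x => by
      have := hψ1 x; have := hpos x; simp only; nlinarith
  have hKM : K ≤ M := integral_mono iG iM fun x => by
    have := hu0 x; have := hu1 x; have := hpos x
    simp only [hψ]
    have : u x ^ 2 ≤ 2 * u x - u x ^ 2 := by nlinarith
    nlinarith
  have hML : M * Real.log A ≤ L := by
    rw [hM, ← integral_mul_const]
    refine integral_mono (iM.mul_const _) iL fun x => ?_
    simp only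
    by_cases hx : u x = 0
    · have : ψ x = 0 := by rw [hψ]; simp [hx]
      rw [this]; simp only [zero_mul]
      exact mul_nonneg (hpos x).le (le_max_right _ _)
    · have h1 := hlog x hx
      have h2 : ψ x * f x ≤ f x := by nlinarith [hψ1 x, hpos x]
      exact mul_le_mul h2 h1 hlogA.le (hpos x).le
  have hCS : D ^ 2 ≤ M * I := by
    have := discrim_le_zero (a := M) (b := -2 * D) (c := I) (fun c => by
      have : ∫ x in unitSquare, ((c * c) * (ψ x * f x) + (-2 * c) * (ψ x * ‖fderiv ℝ f x‖)
          + ‖fderiv ℝ f x‖ ^ 2 / f x) = M * (c * c) + -2 * D * c + I := by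
        rw [integral_add (unitSquare_int _ (by fun_prop)) iI,
          integral_add (iM.const_mul _) (iD.const_mul _), integral_const_mul, integral_const_mul]
        ring
      rw [← this]
      refine integral_nonneg fun x => ?_
      simp only [Pi.zero_apply]
      have e : (c * c) * (ψ x * f x) + (-2 * c) * (ψ x * ‖fderiv ℝ f x‖)
          + ‖fderiv ℝ f x‖ ^ 2 / f x = ψ x * (c * f x - ‖fderiv ℝ f x‖) ^ 2 / f x
          + (1 - ψ x) * ‖fderiv ℝ f x‖ ^ 2 / f x := by
        have := hne x
        field_simp
        ring
      rw [e]
      have h1 := hψ0 x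
      have h2 : 0 ≤ 1 - ψ x := by linarith [hψ1 x]
      have h3 := hpos x
      positivity)
    rw [discrim] at this
    nlinarith
  have hMs : M ≤ Real.sqrt (L / Real.log A) := by
    refine Real.le_sqrt_of_sq_le ?_
    rw [le_div_iff₀ hlogA]
    nlinarith [mul_nonneg hM0 hlogA.le]
  have hG : ∫ x in unitSquare, (f x * u x ^ 2) ^ 2 ≤ 2 * (M * (I + 1)) := by
    refine hS.trans ?_
    nlinarith [sq_nonneg (K - D), mul_nonneg hM0 hI0]
  have hvol : (volume : Measure E2).real unitSquare = 1 := by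
    have := sq_transfer (fun _ => 1)
    simpa [Measure.volume_eq_prod, measureReal_prod_prod] using this
  have hfin : ∫ x in unitSquare, f x ^ 2 ≤
      ∫ x in unitSquare, (2 * (f x * u x ^ 2) ^ 2 + 8 * A ^ 2) := by
    refine integral_mono if2 (unitSquare_int _ (by fun_prop)) fun x => ?_
    simp only
    have h1 := hu0 x; have h2 := hu1 x; have h3 := hpos x
    have h4 : f x * (1 - u x) ≤ A := by
      have := le_max_left (f x - A) 0
      have := hfu x
      nlinarith
    have h5 : f x - f x * u x ^ 2 ≤ 2 * A := by
      have : f x - f x * u x ^ 2 = f x * (1 - u x) * (1 + u x) := by ring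
      rw [this]; nlinarith
    have h6 : 0 ≤ f x * u x ^ 2 := by positivity
    have h7 : f x ^ 2 ≤ (f x * u x ^ 2 + 2 * A) ^ 2 := by
      apply pow_le_pow_left₀ h3.le; linarith
    nlinarith [sq_nonneg (f x * u x ^ 2 - 2 * A)]
  rw [integral_add (iG2.const_mul _) (unitSquare_int _ continuous_const), integral_const_mul,
    setIntegral_const, hvol, one_smul] at hfin
  have hlast : M * (I + 1) ≤ Real.sqrt (L / Real.log A) * (I + 1) :=
    mul_le_mul_of_nonneg_right hMs (by linarith)
  have : 0 ≤ M * (I + 1) := by positivity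
  nlinarith
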